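/- Every real binary quartic form has a unique signature: the set of minimal badges of honest representations by fourth powers of real linear forms has exactly one element. -/

import Mathlib

open MvPolynomial

/-- An honest representation of `p` as a linear combination of `2s`-th powers of
pairwise non-proportional real binary linear forms. -/
def IsHonestRep (s r : ℕ) (p : MvPolynomial (Fin 2) ℝ)
    (lam α β : Fin r → ℝ) : Prop :=
  (∀ k, lam k ≠ 0) ∧
  (∀ k l, k ≠ l → α k * β l - α l * β k ≠ 0) ∧
  p = ∑ k : Fin r, lam k • (α k • X 0 + β k • X 1 : MvPolynomial (Fin 2) ℝ) ^ (2*s)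

/-- The set of badges `(a,b)` of honest representations of `p`, where `a` counts
positive and `b` negative coefficients. -/
def badges (s : ℕ) (p : MvPolynomial (Fin 2) ℝ) : Set (ℕ × ℕ) :=
  { ab | ∃ (r : ℕ) (lam α β : Fin r → ℝ), IsHonestRep s r p lam α β ∧
      ab.1 = Nat.card {k : Fin r // 0 < lam k} ∧
      ab.2 = Nat.card {k : Fin r // lam k < 0} }

/-- A signature of `p` is a minimal badge under the componentwise order. -/
def IsSignature (s : ℕ) (p : MvPolynomial (Fin 2) ℝ) (ab : ℕ × ℕ) : Prop :=
  ab ∈ badges s p ∧ ∀ cd ∈ badges s p, cd.1 ≤ ab.1 → cd.2 ≤ ab.2 → cd = ab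

/-- First coordinate of the representative of a point of the real projective line. -/
def coordX : Option ℝ → ℝ
  | none => 0
  | some _ => 1

/-- Second coordinate of the representative of a point of the real projective line. -/
def coordY : Option ℝ → ℝ
  | none => 1
  | some r => r

/-- The coefficients of `(x X + y Y)⁴`, divided by the binomial coefficients. -/
def veronese (x y : ℝ) : Fin 5 → ℝ :=
  ![x ^ 4, x ^ 3 * y, x ^ 2 * y ^ 2, x * y ^ 3, y ^ 4]

/-- The point of the rational normal quartic above a point of the projective line. -/
def moment (o : Option ℝ) : Fin 5 → ℝ := veronese (coordX o) (coordY o)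

/-- The value at a projective point of the quadratic form with coefficients `u`, `v`, `w`. -/
def quadEval (u v w : ℝ) (o : Option ℝ) : ℝ :=
  u * coordX o ^ 2 + v * (coordX o * coordY o) + w * coordY o ^ 2

/-- The quadratic form of the Hankel matrix of `A`. -/
def hankel (A : Fin 5 → ℝ) (u v w : ℝ) : ℝ :=
  A 0 * u ^ 2 + 2 * A 1 * u * v + A 2 * (v ^ 2 + 2 * u * w) + 2 * A 3 * v * w + A 4 * w ^ 2

/-- The Hankel form of `A` is positive semidefinite. -/
def HankelPSD (A : Fin 5 → ℝ) : Prop := ∀ u v w, 0 ≤ hankel A u v w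

/-- The Hankel form of `A` has a nontrivial isotropic vector. -/
def HankelIsotropic (A : Fin 5 → ℝ) : Prop :=
  ∃ u v w, ¬(u = 0 ∧ v = 0 ∧ w = 0) ∧ hankel A u v w = 0

/-- The number of positive coefficients. -/
noncomputable def posSupport (f : Option ℝ →₀ ℝ) : Finset (Option ℝ) :=
  f.support.filter (fun o => 0 < f o)

/-- `A` is a combination of at most `a` points of the rational normal quartic with positive
coefficients and at most `b` with negative coefficients. -/
def PowerRep (a b : ℕ) (A : Fin 5 → ℝ) : Prop :=
  ∃ f : Option ℝ →₀ ℝ, Finsupp.linearCombination ℝ moment f = A ∧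
    (posSupport f).card ≤ a ∧ (posSupport (-f)).card ≤ b

theorem mem_posSupport {f : Option ℝ →₀ ℝ} {o : Option ℝ} : o ∈ posSupport f ↔ 0 < f o := by
  simp only [posSupport, Finset.mem_filter, Finsupp.mem_support_iff, and_iff_right_iff_imp]
  exact fun h => h.ne'

theorem posSupport_add_subset (f g : Option ℝ →₀ ℝ) :
    posSupport (f + g) ⊆ posSupport f ∪ posSupport g := by
  intro o
  simp only [Finset.mem_union, mem_posSupport, Finsupp.add_apply]
  intro h
  by_contra! h'
  linarith

theorem card_posSupport_add_le (f g : Option ℝ →₀ ℝ) :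
    (posSupport (f + g)).card ≤ (posSupport f).card + (posSupport g).card :=
  (Finset.card_le_card (posSupport_add_subset f g)).trans (Finset.card_union_le _ _)

theorem PowerRep.add {a b c d : ℕ} {A B : Fin 5 → ℝ} (hA : PowerRep a b A) (hB : PowerRep c d B) :
    PowerRep (a + c) (b + d) (A + B) := by
  obtain ⟨f, rfl, hf, hf'⟩ := hA
  obtain ⟨g, rfl, hg, hg'⟩ := hB
  refine ⟨f + g, map_add _ _ _, ?_, ?_⟩
  · exact (card_posSupport_add_le f g).trans (add_le_add hf hg)
  · rw [neg_add]
    exact (card_posSupport_add_le _ _).trans (add_le_add hf' hg')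

theorem PowerRep.neg {a b : ℕ} {A : Fin 5 → ℝ} (hA : PowerRep a b A) : PowerRep b a (-A) := by
  obtain ⟨f, rfl, hf, hf'⟩ := hA
  exact ⟨-f, map_neg _ _, hf', by rwa [neg_neg]⟩

theorem PowerRep.mono {a b c d : ℕ} {A : Fin 5 → ℝ} (hA : PowerRep a b A) (hac : a ≤ c) (hbd : b ≤ d) :
    PowerRep c d A := by
  obtain ⟨f, hA, hf, hf'⟩ := hA
  exact ⟨f, hA, hf.trans hac, hf'.trans hbd⟩

theorem PowerRep.zero : PowerRep 0 0 0 :=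
  ⟨0, map_zero _, by simp [posSupport], by simp [posSupport]⟩

theorem PowerRep.smul_moment {t : ℝ} (ht : 0 ≤ t) (o : Option ℝ) : PowerRep 1 0 (t • moment o) := by
  refine ⟨Finsupp.single o t, Finsupp.linearCombination_single _ _ _, ?_, ?_⟩
  · exact (Finset.card_le_card ((Finset.filter_subset _ _).trans
      Finsupp.support_single_subset)).trans (Finset.card_singleton o).le
  · rw [Nat.le_zero, Finset.card_eq_zero, Finset.eq_empty_iff_forall_notMem]
    intro i hi
    rw [mem_posSupport, Finsupp.neg_apply, Finsupp.single_apply] at hi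
    split_ifs at hi <;> linarith

theorem hankel_add (A B : Fin 5 → ℝ) (u v w : ℝ) :
    hankel (A + B) u v w = hankel A u v w + hankel B u v w := by
  simp only [hankel, Pi.add_apply]; ring

theorem hankel_smul (t : ℝ) (A : Fin 5 → ℝ) (u v w : ℝ) :
    hankel (t • A) u v w = t * hankel A u v w := by
  simp only [hankel, Pi.smul_apply, smul_eq_mul]; ring

theorem hankel_neg (A : Fin 5 → ℝ) (u v w : ℝ) : hankel (-A) u v w = -hankel A u v w := by
  simp only [hankel, Pi.neg_apply]; ring

theorem hankel_moment (o : Option ℝ) (u v w : ℝ) :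
    hankel (moment o) u v w = quadEval u v w o ^ 2 := by
  simp only [hankel, moment, veronese, quadEval, Matrix.cons_val]
  ring

theorem hankel_linearCombination (f : Option ℝ →₀ ℝ) (u v w : ℝ) :
    hankel (Finsupp.linearCombination ℝ moment f) u v w =
      ∑ o ∈ f.support, f o * quadEval u v w o ^ 2 := by
  change _ = f.sum fun o c => c * quadEval u v w o ^ 2
  induction f using Finsupp.induction_linear with
  | zero => simp [hankel]
  | add f g hf hg =>
    rw [map_add, hankel_add, hf, hg, Finsupp.sum_add_index'] <;> intros <;> ring
  | single o c =>
    rw [Finsupp.linearCombination_single, hankel_smul, hankel_moment, Finsupp.sum_single_index]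
    ring

theorem hankel_nonneg_of_eval_eq_zero {f : Option ℝ →₀ ℝ} {u v w : ℝ}
    (h : ∀ o ∈ posSupport (-f), quadEval u v w o = 0) :
    0 ≤ hankel (Finsupp.linearCombination ℝ moment f) u v w := by
  rw [hankel_linearCombination]
  refine Finset.sum_nonneg fun o _ => ?_
  rcases lt_or_ge (f o) 0 with h0 | h0
  · rw [h o (mem_posSupport.2 (by simpa using h0))]
    simp
  · positivity

theorem hankel_nonpos_of_eval_eq_zero {f : Option ℝ →₀ ℝ} {u v w : ℝ}
    (h : ∀ o ∈ posSupport f, quadEval u v w o = 0) :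
    hankel (Finsupp.linearCombination ℝ moment f) u v w ≤ 0 := by
  have := hankel_nonneg_of_eval_eq_zero (f := -f) (u := u) (v := v) (w := w) (by rwa [neg_neg])
  rw [map_neg, hankel_neg] at this
  linarith

theorem PowerRep.hankelPSD {a : ℕ} {A : Fin 5 → ℝ} (h : PowerRep a 0 A) : HankelPSD A := by
  obtain ⟨f, rfl, -, hf⟩ := h
  rw [Nat.le_zero, Finset.card_eq_zero] at hf
  exact fun u v w => hankel_nonneg_of_eval_eq_zero (by simp [hf])

/-- A representation with one more negative term arises by subtracting a fourth power. -/
theorem PowerRep.exists_add_smul_moment {a b : ℕ} {A : Fin 5 → ℝ} (h : PowerRep a (b + 1) A) :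
    ∃ (o : Option ℝ) (t : ℝ), 0 ≤ t ∧ PowerRep a b (A + t • moment o) := by
  obtain ⟨f, rfl, hf, hf'⟩ := h
  rcases (posSupport (-f)).eq_empty_or_nonempty with he | ⟨o, ho⟩
  · exact ⟨none, 0, le_rfl, f, by simp, hf, by simp [he]⟩
  · have ho' := mem_posSupport.1 ho
    rw [Finsupp.neg_apply] at ho'
    refine ⟨o, -f o, ho'.le, f + Finsupp.single o (-f o), ?_, ?_, ?_⟩
    · rw [map_add, Finsupp.linearCombination_single]
    · refine (Finset.card_le_card fun i hi => ?_).trans hf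
      rw [mem_posSupport, Finsupp.add_apply, Finsupp.single_apply] at *
      split_ifs at hi with hio
      · subst hio; linarith
      · simpa using hi
    · have hsub : posSupport (-(f + Finsupp.single o (-f o))) ⊆ (posSupport (-f)).erase o := by
        intro i hi
        rw [Finset.mem_erase]
        rw [mem_posSupport, Finsupp.neg_apply, Finsupp.add_apply, Finsupp.single_apply] at *
        split_ifs at hi with hio
        · subst hio; linarith
        · exact ⟨Ne.symm hio, by simpa using hi⟩
      have := Finset.card_le_card hsub
      rw [Finset.card_erase_of_mem ho] at this
      omega

theorem coord_det_eq_zero_iff (o k : Option ℝ) :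
    coordX o * coordY k - coordX k * coordY o = 0 ↔ o = k := by
  cases o <;> cases k <;> simp [coordX, coordY, sub_eq_zero, eq_comm]

/-- There is a nonzero quadratic form vanishing exactly at two given points. -/
theorem exists_quadEval_eq_zero_iff (k m : Option ℝ) : ∃ u v w : ℝ, ¬(u = 0 ∧ v = 0 ∧ w = 0) ∧
    ∀ o, quadEval u v w o = 0 ↔ o = k ∨ o = m := by
  have key (k m o : Option ℝ) : quadEval (coordY k * coordY m)
      (-(coordY k * coordX m + coordX k * coordY m)) (coordX k * coordX m) o =
      (coordX o * coordY k - coordX k * coordY o) * (coordX o * coordY m - coordX m * coordY o) := by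
    simp only [quadEval]; ring
  refine ⟨coordY k * coordY m, -(coordY k * coordX m + coordX k * coordY m),
    coordX k * coordX m, ?_, fun o => by
      rw [key, mul_eq_zero, coord_det_eq_zero_iff, coord_det_eq_zero_iff]⟩
  rintro ⟨h1, h2, h3⟩
  cases k <;> cases m <;> simp_all [coordX, coordY]

theorem exists_subset_pair {s : Finset (Option ℝ)} (hs : s.card ≤ 2) :
    ∃ k m, ∀ o ∈ s, o = k ∨ o = m := by
  interval_cases h : s.card
  · exact ⟨none, none, by simp [Finset.card_eq_zero.1 h]⟩
  · obtain ⟨k, rfl⟩ := Finset.card_eq_one.1 h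
    exact ⟨k, k, by simp⟩
  · obtain ⟨k, m, -, rfl⟩ := Finset.card_eq_two.1 h
    exact ⟨k, m, by simp⟩

theorem exists_subset_singleton {s : Finset (Option ℝ)} (hs : s.card ≤ 1) :
    ∃ k, ∀ o ∈ s, o = k := by
  obtain ⟨k, hk⟩ := Finset.card_le_one_iff_subset_singleton.1 hs
  exact ⟨k, fun o ho => Finset.mem_singleton.1 (hk ho)⟩

/-- An isotropic vector of a positive semidefinite Hankel form lies in its kernel. -/
theorem HankelPSD.kernel {A : Fin 5 → ℝ} (hA : HankelPSD A) {u v w : ℝ}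
    (h : hankel A u v w = 0) :
    A 0 * u + A 1 * v + A 2 * w = 0 ∧ A 1 * u + A 2 * v + A 3 * w = 0 ∧
      A 2 * u + A 3 * v + A 4 * w = 0 := by
  have key (x y z : ℝ) : x * (A 0 * u + A 1 * v + A 2 * w) + y * (A 1 * u + A 2 * v + A 3 * w)
      + z * (A 2 * u + A 3 * v + A 4 * w) = 0 := by
    set B := x * (A 0 * u + A 1 * v + A 2 * w) + y * (A 1 * u + A 2 * v + A 3 * w)
      + z * (A 2 * u + A 3 * v + A 4 * w) with hB
    have hexp (t : ℝ) : 0 ≤ hankel A x y z * (t * t) + 2 * B * t + 0 := by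
      have := hA (u + t * x) (v + t * y) (w + t * z)
      have e : hankel A (u + t * x) (v + t * y) (w + t * z) =
          hankel A u v w + (hankel A x y z * (t * t) + 2 * B * t) := by
        simp only [hankel, hB]; ring
      rw [e, h] at this
      linarith
    have := discrim_le_zero hexp
    rw [discrim] at this
    nlinarith [sq_nonneg B]
  exact ⟨by simpa using key 1 0 0, by simpa using key 0 1 0, by simpa using key 0 0 1⟩

theorem HankelPSD.rep_zero {A : Fin 5 → ℝ} (hA : HankelPSD A) {b : ℕ} (h : PowerRep 0 b A) :
    PowerRep 0 0 A := by
  have hz : ∀ u v w, hankel A u v w = 0 := fun u v w => by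
    have := h.neg.hankelPSD u v w
    rw [hankel_neg] at this
    linarith [hA u v w]
  have h0 := hA.kernel (hz 1 0 0)
  have h2 := hA.kernel (hz 0 0 1)
  have : A = 0 := by
    ext i
    fin_cases i <;> simp_all
  rw [this]
  exact PowerRep.zero

theorem HankelPSD.rep_one {A : Fin 5 → ℝ} (hA : HankelPSD A) {b : ℕ} (h : PowerRep 1 b A) :
    PowerRep 1 0 A := by
  obtain ⟨f, hf, hf1, -⟩ := h
  obtain ⟨m, hm⟩ := exists_subset_singleton hf1
  have hz (u v w : ℝ) (he : quadEval u v w m = 0) := hA.kernel (le_antisymm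
    (hf ▸ hankel_nonpos_of_eval_eq_zero fun o ho => (hm o ho).symm ▸ he) (hA u v w))
  cases m with
  | none =>
    have h1 := hz 1 0 0 (by simp [quadEval, coordX, coordY])
    have h2 := hz 0 1 0 (by simp [quadEval, coordX, coordY])
    have h4 := hA 0 0 1
    have : A = A 4 • moment none := by
      ext i
      fin_cases i <;> simp_all [moment, veronese, coordX, coordY]
    rw [this]
    exact PowerRep.smul_moment (by simpa [hankel] using h4) _
  | some r =>
    have h1 := hz (-r) 1 0 (by simp [quadEval, coordX, coordY])
    have h2 := hz 0 (-r) 1 (by simp [quadEval, coordX, coordY]; ring)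
    have h4 := hA 1 0 0
    have e1 : A 1 = A 0 * r := by linarith [h1.1]
    have e2 : A 2 = A 0 * r ^ 2 := by rw [pow_two, ← mul_assoc, ← e1]; linarith [h1.2.1]
    have e3 : A 3 = A 0 * r ^ 3 := by rw [pow_succ, ← mul_assoc, ← e2]; linarith [h1.2.2]
    have e4 : A 4 = A 0 * r ^ 4 := by rw [pow_succ, ← mul_assoc, ← e3]; linarith [h2.2.2]
    have : A = A 0 • moment (some r) := by
      ext i
      fin_cases i <;> simp [moment, veronese, coordX, coordY, e1, e2, e3, e4]
    rw [this]
    exact PowerRep.smul_moment (by simpa [hankel] using h4) _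

/-- Two-point quadrature for a positive definite two by two Hankel matrix. -/
theorem exists_two_point_quadrature {a b c d : ℝ} (ha : 0 < a) (hD : 0 < a * c - b ^ 2) :
    ∃ r s u w : ℝ, r ≠ s ∧ 0 < u ∧ 0 < w ∧ a = u + w ∧ b = u * r + w * s ∧
      c = u * r ^ 2 + w * s ^ 2 ∧ d = u * r ^ 3 + w * s ^ 3 := by
  set D := a * c - b ^ 2 with hDdef
  set E := a * d - b * c with hE
  set F := b * d - c ^ 2 with hF
  have hdisc : 0 < E ^ 2 - 4 * D * F := by
    have e : a ^ 2 * (E ^ 2 - 4 * D * F) =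
        (a ^ 2 * d - 3 * a * b * c + 2 * b ^ 3) ^ 2 + 4 * D ^ 3 := by
      simp only [hDdef, hE, hF]; ring
    have : 0 < a ^ 2 * (E ^ 2 - 4 * D * F) := by rw [e]; positivity
    exact pos_of_mul_pos_right this (by positivity)
  obtain ⟨q, hq, hqq⟩ : ∃ q : ℝ, 0 < q ∧ q ^ 2 = E ^ 2 - 4 * D * F :=
    ⟨_, Real.sqrt_pos.2 hdisc, Real.sq_sqrt hdisc.le⟩
  obtain ⟨r, hr⟩ : ∃ r, r = (E + q) / (2 * D) := ⟨_, rfl⟩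
  obtain ⟨s, hs⟩ : ∃ s, s = (E - q) / (2 * D) := ⟨_, rfl⟩
  have hsum : D * (r + s) = E := by rw [hr, hs]; field_simp; ring
  have hprod : D * (r * s) = F := by
    rw [hr, hs]; field_simp; linear_combination -hqq
  have hrs : 0 < r - s := by
    have : r - s = q / D := by rw [hr, hs]; field_simp; ring
    rw [this]; positivity
  have hc : c = (r + s) * b - r * s * a := by
    apply mul_left_cancel₀ hD.ne'
    linear_combination (-b) * hsum + a * hprod + c * hDdef - b * hE + a * hF
  have hd : d = (r + s) * c - r * s * b := by
    apply mul_left_cancel₀ hD.ne'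
    linear_combination (-c) * hsum + b * hprod + d * hDdef - c * hE + b * hF
  obtain ⟨u, hu⟩ : ∃ u, u = (b - s * a) / (r - s) := ⟨_, rfl⟩
  obtain ⟨w, hw⟩ : ∃ w, w = (r * a - b) / (r - s) := ⟨_, rfl⟩
  have ea : a = u + w := by rw [hu, hw]; field_simp; ring
  have eb : b = u * r + w * s := by rw [hu, hw]; field_simp; ring
  have ec : c = u * r ^ 2 + w * s ^ 2 := by rw [hc, eb, ea]; ring
  have ed : d = u * r ^ 3 + w * s ^ 3 := by rw [hd, ec, eb]; ring
  have huw : 0 < u * w := by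
    have : D = u * w * (r - s) ^ 2 := by rw [hDdef, ec, eb, ea]; ring
    rw [this] at hD
    exact pos_of_mul_pos_left hD (by positivity)
  refine ⟨r, s, u, w, (sub_pos.1 hrs).ne', ?_, ?_, ea, eb, ec, ed⟩ <;>
  · by_contra! h
    nlinarith

theorem HankelPSD.rep_three {A : Fin 5 → ℝ} (hA : HankelPSD A) :
    PowerRep 3 0 A ∧ (HankelIsotropic A → PowerRep 2 0 A) := by
  have h0 : 0 ≤ A 0 := by simpa [hankel] using hA 1 0 0
  rcases h0.eq_or_lt with h0 | h0
  · replace h0 := h0.symm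
    have h1 := hA.kernel (u := 1) (v := 0) (w := 0) (by simp [hankel, h0])
    have h2 := hA.kernel (u := 0) (v := 1) (w := 0) (by simp_all [hankel])
    have h4 : 0 ≤ A 4 := by simpa [hankel] using hA 0 0 1
    have : A = A 4 • moment none := by
      ext i
      fin_cases i <;> simp_all [moment, veronese, coordX, coordY]
    have hr : PowerRep 1 0 A := by rw [this]; exact PowerRep.smul_moment h4 _
    exact ⟨hr.mono (by norm_num) le_rfl, fun _ => hr.mono (by norm_num) le_rfl⟩
  have hD : 0 ≤ A 0 * A 2 - A 1 ^ 2 := by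
    have := hA (-A 1) (A 0) 0
    have e : hankel A (-A 1) (A 0) 0 = A 0 * (A 0 * A 2 - A 1 ^ 2) := by
      simp only [hankel]; ring
    rw [e] at this
    exact nonneg_of_mul_nonneg_right this h0
  rcases hD.eq_or_lt with hD | hD
  · have hk := hA.kernel (u := -A 1) (v := A 0) (w := 0) (by
      simp only [hankel]; linear_combination -(A 0) * hD)
    obtain ⟨r, hr⟩ : ∃ r, r = A 1 / A 0 := ⟨_, rfl⟩
    have e1 : A 1 = A 0 * r := by rw [hr]; field_simp
    have e2 : A 2 = A 0 * r ^ 2 := by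
      apply mul_left_cancel₀ h0.ne'; rw [e1] at hD; linarith
    have e3 : A 3 = A 0 * r ^ 3 := by
      apply mul_left_cancel₀ h0.ne'; rw [e1, e2] at hk; linarith [hk.2.2]
    have h4 : 0 ≤ A 4 - A 0 * r ^ 4 := by
      have := hA (r ^ 2) (-(2 * r)) 1
      have e : hankel A (r ^ 2) (-(2 * r)) 1 = A 4 - A 0 * r ^ 4 := by
        simp only [hankel, e1, e2, e3]; ring
      rwa [e] at this
    have : A = A 0 • moment (some r) + (A 4 - A 0 * r ^ 4) • moment none := by
      ext i
      fin_cases i <;> simp [moment, veronese, coordX, coordY, e1, e2, e3]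
    have hr : PowerRep 2 0 A := by
      rw [this]; exact (PowerRep.smul_moment h0.le _).add (PowerRep.smul_moment h4 _)
    exact ⟨hr.mono (by norm_num) le_rfl, fun _ => hr⟩
  · obtain ⟨r, s, u, w, hrs, hu, hw, e0, e1, e2, e3⟩ :=
      exists_two_point_quadrature (d := A 3) h0 hD
    obtain ⟨z, hz⟩ : ∃ z, z = A 4 - u * r ^ 4 - w * s ^ 4 := ⟨_, rfl⟩
    have e4 : A 4 = u * r ^ 4 + w * s ^ 4 + z := by rw [hz]; ring
    have hform (x y t : ℝ) : hankel A x y t = u * (x + y * r + t * r ^ 2) ^ 2 +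
        w * (x + y * s + t * s ^ 2) ^ 2 + z * t ^ 2 := by
      simp only [hankel, e0, e1, e2, e3, e4]; ring
    have hz0 : 0 ≤ z := by
      have := hA (r * s) (-(r + s)) 1
      rw [hform] at this
      ring_nf at this
      exact this
    have hsum : A = u • moment (some r) + w • moment (some s) + z • moment none := by
      ext i
      fin_cases i <;> simp [moment, veronese, coordX, coordY, e0, e1, e2, e3, e4]
    have h2 : PowerRep 2 0 (u • moment (some r) + w • moment (some s)) :=
      (PowerRep.smul_moment hu.le _).add (PowerRep.smul_moment hw.le _)
    refine ⟨by rw [hsum]; exact h2.add (PowerRep.smul_moment hz0 _), ?_⟩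
    rintro ⟨x, y, t, hne, hxyt⟩
    rcases hz0.eq_or_lt with hz0 | hz0
    · rw [hsum, ← hz0, zero_smul, add_zero]; exact h2
    · exfalso
      apply hne
      rw [hform] at hxyt
      have p1 : 0 ≤ u * (x + y * r + t * r ^ 2) ^ 2 := by positivity
      have p2 : 0 ≤ w * (x + y * s + t * s ^ 2) ^ 2 := by positivity
      have p3 : 0 ≤ z * t ^ 2 := by positivity
      have q1 : u * (x + y * r + t * r ^ 2) ^ 2 = 0 := by linarith
      have q2 : w * (x + y * s + t * s ^ 2) ^ 2 = 0 := by linarith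
      have q3 : z * t ^ 2 = 0 := by linarith
      simp only [mul_eq_zero, hu.ne', hw.ne', hz0.ne', false_or, pow_eq_zero_iff, ne_eq,
        OfNat.ofNat_ne_zero, not_false_eq_true] at q1 q2 q3
      subst q3
      have hy : y * (r - s) = 0 := by linarith
      have hy : y = 0 := (mul_eq_zero.1 hy).resolve_right (sub_ne_zero.2 hrs)
      subst hy
      exact ⟨by linarith, rfl, rfl⟩

theorem HankelPSD.rep_of_rep {A : Fin 5 → ℝ} (hA : HankelPSD A) {a b : ℕ} (h : PowerRep a b A) :
    PowerRep a 0 A := by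
  match a with
  | 0 => exact hA.rep_zero h
  | 1 => exact hA.rep_one h
  | 2 =>
    obtain ⟨f, hf, hf1, -⟩ := h
    obtain ⟨k, m, hkm⟩ := exists_subset_pair hf1
    obtain ⟨u, v, w, hne, hev⟩ := exists_quadEval_eq_zero_iff k m
    refine hA.rep_three.2 ⟨u, v, w, hne, le_antisymm ?_ (hA u v w)⟩
    rw [← hf]
    exact hankel_nonpos_of_eval_eq_zero fun o ho => (hev o).2 (hkm o ho)
  | a + 3 => exact hA.rep_three.1.mono (by omega) le_rfl

theorem exists_hankel_isotropic_sub {B : Fin 5 → ℝ} (hB : HankelPSD B) {T : ℝ} (hT : 0 ≤ T)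
    (o : Option ℝ) (hn : ¬HankelPSD (B - T • moment o)) :
    ∃ s, 0 ≤ s ∧ s ≤ T ∧ HankelPSD (B - s • moment o) ∧ HankelIsotropic (B - s • moment o) := by
  by_cases hiso : HankelIsotropic B
  · exact ⟨0, le_rfl, hT, by simpa using hB, by simpa using hiso⟩
  have hsub (s u v w : ℝ) : hankel (B - s • moment o) u v w =
      hankel B u v w - s * quadEval u v w o ^ 2 := by
    rw [sub_eq_add_neg, hankel_add, hankel_neg, hankel_smul, hankel_moment, ← sub_eq_add_neg]
  obtain ⟨p, q, r, h1, h2, h3⟩ : ∃ p q r, B 0 * p + B 1 * q + B 2 * r = coordX o ^ 2 ∧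
      B 1 * p + B 2 * q + B 3 * r = coordX o * coordY o ∧
      B 2 * p + B 3 * q + B 4 * r = coordY o ^ 2 := by
    let M : Matrix (Fin 3) (Fin 3) ℝ := !![B 0, B 1, B 2; B 1, B 2, B 3; B 2, B 3, B 4]
    have hdet : M.det ≠ 0 := by
      intro h
      obtain ⟨x, hx, hMx⟩ := Matrix.exists_mulVec_eq_zero_iff.2 h
      have m0 := congrFun hMx 0
      have m1 := congrFun hMx 1
      have m2 := congrFun hMx 2
      simp [M, Matrix.mulVec, dotProduct, Fin.sum_univ_three] at m0 m1 m2
      refine hiso ⟨x 0, x 1, x 2, fun h => hx ?_, ?_⟩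
      · ext i; fin_cases i <;> simp [h]
      · simp only [hankel]
        linear_combination x 0 * m0 + x 1 * m1 + x 2 * m2
    have hM : M.mulVec (M⁻¹.mulVec ![coordX o ^ 2, coordX o * coordY o, coordY o ^ 2]) =
        ![coordX o ^ 2, coordX o * coordY o, coordY o ^ 2] := by
      rw [Matrix.mulVec_mulVec, Matrix.mul_nonsing_inv _ (isUnit_iff_ne_zero.2 hdet),
        Matrix.one_mulVec]
    generalize M⁻¹.mulVec ![coordX o ^ 2, coordX o * coordY o, coordY o ^ 2] = x at hM
    have m0 := congrFun hM 0
    have m1 := congrFun hM 1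
    have m2 := congrFun hM 2
    simp [M, Matrix.mulVec, dotProduct, Fin.sum_univ_three] at m0 m1 m2
    exact ⟨x 0, x 1, x 2, m0, m1, m2⟩
  have hne : ¬(p = 0 ∧ q = 0 ∧ r = 0) := by
    rintro ⟨rfl, rfl, rfl⟩
    cases o <;> simp [coordX, coordY] at h1 h3
  obtain ⟨c, hc⟩ : ∃ c, c = quadEval p q r o := ⟨_, rfl⟩
  have hcB : hankel B p q r = c := by
    simp only [hankel, hc, quadEval]
    linear_combination p * h1 + q * h2 + r * h3
  have hcpos : 0 < c := by
    refine lt_of_le_of_ne (hcB ▸ hB p q r) fun h => hiso ⟨p, q, r, hne, by rw [hcB, h]⟩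
  have hcs (u v w : ℝ) : quadEval u v w o ^ 2 ≤ c * hankel B u v w := by
    obtain ⟨e, he⟩ : ∃ e, e = quadEval u v w o := ⟨_, rfl⟩
    have := hB (c * u - e * p) (c * v - e * q) (c * w - e * r)
    have ex : hankel B (c * u - e * p) (c * v - e * q) (c * w - e * r) =
        c * (c * hankel B u v w - e ^ 2) := by
      have hcr : u * (B 0 * p + B 1 * q + B 2 * r) + v * (B 1 * p + B 2 * q + B 3 * r) +
          w * (B 2 * p + B 3 * q + B 4 * r) = e := by
        rw [h1, h2, h3, he, quadEval]
      have : hankel B (c * u - e * p) (c * v - e * q) (c * w - e * r) =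
          c ^ 2 * hankel B u v w - 2 * c * e * (u * (B 0 * p + B 1 * q + B 2 * r) +
          v * (B 1 * p + B 2 * q + B 3 * r) + w * (B 2 * p + B 3 * q + B 4 * r)) +
          e ^ 2 * hankel B p q r := by
        simp only [hankel]; ring
      rw [this, hcr, hcB]; ring
    rw [ex] at this
    rw [← he]
    linarith [nonneg_of_mul_nonneg_right this hcpos]
  have hpsd : HankelPSD (B - c⁻¹ • moment o) := fun u v w => by
    rw [hsub, sub_nonneg, inv_mul_le_iff₀ hcpos]
    exact hcs u v w
  refine ⟨c⁻¹, by positivity, ?_, hpsd, p, q, r, hne, ?_⟩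
  · by_contra! hlt
    refine hn fun u v w => ?_
    have := hpsd u v w
    rw [hsub] at this ⊢
    nlinarith [sq_nonneg (quadEval u v w o)]
  · rw [hsub, hcB, ← hc]
    field_simp
    ring

theorem rep_two_one_of_hankelPSD_add {A : Fin 5 → ℝ} (hA : ¬HankelPSD A) {T : ℝ} (hT : 0 ≤ T)
    (o : Option ℝ) (h : HankelPSD (A + T • moment o)) : PowerRep 2 1 A := by
  obtain ⟨s, hs, hsT, hp, hi⟩ := exists_hankel_isotropic_sub h hT o (by simpa using hA)
  have h2 := (hp.rep_three.2 hi).add (PowerRep.smul_moment (sub_nonneg.2 hsT) o).neg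
  convert h2 using 1
  module

theorem PowerRep.two_one {A : Fin 5 → ℝ} (hA : ¬HankelPSD A) {a : ℕ} (h : PowerRep a 1 A) : PowerRep 2 1 A := by
  obtain ⟨o, t, ht, hr⟩ := h.exists_add_smul_moment
  exact rep_two_one_of_hankelPSD_add hA ht o hr.hankelPSD

theorem rep_two_two_of_hankelPSD_add {A : Fin 5 → ℝ} (hA : ¬HankelPSD A) {S T : ℝ} (hS : 0 ≤ S)
    (hT : 0 ≤ T) (o o' : Option ℝ) (h : HankelPSD (A + S • moment o + T • moment o')) :
    PowerRep 2 2 A := by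
  by_cases h' : HankelPSD (A + S • moment o)
  · exact (rep_two_one_of_hankelPSD_add hA hS o h').mono le_rfl (by norm_num)
  · have := (rep_two_one_of_hankelPSD_add h' hT o' h).add (PowerRep.smul_moment hS o).neg
    simpa using this

/-- A quadratic form positive on an axis becomes nonnegative after adding a large multiple of
the squares of the other coordinates. -/
theorem exists_nonneg_add_mul_sq {κ : ℝ} (hκ : 0 < κ) (p q r s t : ℝ) :
    ∃ T, 0 ≤ T ∧ ∀ c e f : ℝ, 0 ≤ κ * c ^ 2 + 2 * c * (p * e + q * f) + r * e ^ 2 +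
      2 * s * e * f + t * f ^ 2 + T * (e ^ 2 + f ^ 2) := by
  refine ⟨2 * p ^ 2 / κ + 2 * q ^ 2 / κ + |r| + |s| + |t|, by positivity, fun c e f => ?_⟩
  have h1 : 0 ≤ κ / 2 * (c + 2 * p * e / κ) ^ 2 := by positivity
  have h2 : 0 ≤ κ / 2 * (c + 2 * q * f / κ) ^ 2 := by positivity
  have e1 : κ / 2 * (c + 2 * p * e / κ) ^ 2 =
      κ / 2 * c ^ 2 + 2 * c * p * e + 2 * p ^ 2 / κ * e ^ 2 := by field_simp; ring
  have e2 : κ / 2 * (c + 2 * q * f / κ) ^ 2 =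
      κ / 2 * c ^ 2 + 2 * c * q * f + 2 * q ^ 2 / κ * f ^ 2 := by field_simp; ring
  have h3 : 0 ≤ 2 * p ^ 2 / κ * f ^ 2 := by positivity
  have h4 : 0 ≤ 2 * q ^ 2 / κ * e ^ 2 := by positivity
  have h5 : 0 ≤ (|r| + r) * e ^ 2 := mul_nonneg (by linarith [neg_abs_le r]) (sq_nonneg _)
  have h6 : 0 ≤ (|t| + t) * f ^ 2 := mul_nonneg (by linarith [neg_abs_le t]) (sq_nonneg _)
  have h7 : 0 ≤ |r| * f ^ 2 := by positivity
  have h8 : 0 ≤ |t| * e ^ 2 := by positivity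
  have h9 : 0 ≤ (|s| + s) * (e + f) ^ 2 := mul_nonneg (by linarith [neg_abs_le s]) (sq_nonneg _)
  have h10 : 0 ≤ (|s| - s) * (e - f) ^ 2 := mul_nonneg (by linarith [le_abs_self s]) (sq_nonneg _)
  linarith

theorem rep_two_two_of_pos_left {A : Fin 5 → ℝ} (hA : ¬HankelPSD A) {r : ℝ}
    (h : 0 < A 2 - 2 * r * A 1 + r ^ 2 * A 0) : PowerRep 2 2 A := by
  obtain ⟨T, hT, hpos⟩ := exists_nonneg_add_mul_sq h (A 1 - r * A 0)
    (A 3 - r * A 2 - r ^ 2 * (A 1 - r * A 0)) (A 0) (A 2 - r ^ 2 * A 0)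
    (A 4 - 2 * r ^ 2 * A 2 + r ^ 4 * A 0)
  refine rep_two_two_of_hankelPSD_add hA hT hT none (some r) fun u v w => ?_
  have := hpos v (u + v * r + w * r ^ 2) w
  rw [hankel_add, hankel_add, hankel_smul, hankel_smul, hankel_moment, hankel_moment]
  simp only [quadEval, coordX, coordY, hankel]
  linarith

theorem rep_two_two_of_ne_zero {A : Fin 5 → ℝ} (hA : ¬HankelPSD A) (h0 : A 0 = 0)
    (h1 : A 1 = 0) (h2 : A 2 = 0) (h3 : A 3 ≠ 0) : PowerRep 2 2 A := by
  obtain ⟨r, hr0, hr⟩ : ∃ r, r ≠ 0 ∧ 0 < A 4 - 2 * r * A 3 := by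
    refine ⟨-((|A 4| + 1) / (2 * A 3)), neg_ne_zero.2 (by positivity), ?_⟩
    have : A 4 - 2 * -((|A 4| + 1) / (2 * A 3)) * A 3 = A 4 + |A 4| + 1 := by field_simp; ring
    rw [this]
    linarith [neg_abs_le (A 4)]
  obtain ⟨T, hT, hpos⟩ := exists_nonneg_add_mul_sq hr (-(r⁻¹ * A 3)) (r⁻¹ * A 3) 0 0 0
  refine rep_two_two_of_hankelPSD_add hA hT hT (some 0) (some r) fun u v w => ?_
  have := hpos w u (u + v * r + w * r ^ 2)
  rw [hankel_add, hankel_add, hankel_smul, hankel_smul, hankel_moment, hankel_moment]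
  simp only [quadEval, coordX, coordY, hankel, h0, h1, h2]
  have e : 2 * w * (-(r⁻¹ * A 3) * u + r⁻¹ * A 3 * (u + v * r + w * r ^ 2)) =
      2 * w * A 3 * (v + w * r) := by field_simp; ring
  rw [e] at this
  linarith

theorem rep_two_two_of_indefinite {A : Fin 5 → ℝ} (hA : ¬HankelPSD A) (hA' : ¬HankelPSD (-A)) :
    PowerRep 2 2 A := by
  by_cases h : ∀ r, A 2 - 2 * r * A 1 + r ^ 2 * A 0 = 0
  · have e0 := h 0
    have e1 := h 1
    have e2 := h (-1)
    have h2 : A 2 = 0 := by linarith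
    have h1 : A 1 = 0 := by linarith
    have h0 : A 0 = 0 := by linarith
    refine rep_two_two_of_ne_zero hA h0 h1 h2 fun h3 => ?_
    have hform (u v w : ℝ) : hankel A u v w = A 4 * w ^ 2 := by simp [hankel, h0, h1, h2, h3]
    rcases le_total 0 (A 4) with h4 | h4
    · exact hA fun u v w => by rw [hform]; positivity
    · refine hA' fun u v w => ?_
      rw [hankel_neg, hform]
      nlinarith [sq_nonneg w]
  · push Not at h
    obtain ⟨r, hr⟩ := h
    rcases hr.lt_or_gt with hr | hr
    · have := rep_two_two_of_pos_left hA' (r := r) (by simp only [Pi.neg_apply]; linarith)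
      simpa using this.neg
    · exact rep_two_two_of_pos_left hA hr

theorem PowerRep.one_one {A : Fin 5 → ℝ} (h : PowerRep 2 1 A) {b : ℕ} (h' : PowerRep 1 b A) :
    PowerRep 1 1 A := by
  obtain ⟨f, rfl, -, hf⟩ := h
  by_cases hA : HankelPSD (Finsupp.linearCombination ℝ moment f)
  · exact (hA.rep_one h').mono le_rfl (by norm_num)
  obtain ⟨k, hk⟩ := exists_subset_singleton hf
  have hfk : f k < 0 := by
    by_contra! hfk
    refine hA fun u v w => hankel_nonneg_of_eval_eq_zero fun o ho => ?_
    have ho' := mem_posSupport.1 ho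
    rw [hk o ho, Finsupp.neg_apply] at ho'
    linarith
  obtain ⟨g, hg, hg1, -⟩ := h'
  obtain ⟨m, hm⟩ := exists_subset_singleton hg1
  obtain ⟨u, v, w, -, hev⟩ := exists_quadEval_eq_zero_iff k m
  have hle : hankel (Finsupp.linearCombination ℝ moment f) u v w ≤ 0 :=
    hg ▸ hankel_nonpos_of_eval_eq_zero fun o ho => (hev o).2 (Or.inr (hm o ho))
  have hterm : ∀ o ∈ f.support, 0 ≤ f o * quadEval u v w o ^ 2 := fun o _ => by
    rcases lt_or_ge (f o) 0 with h0 | h0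
    · rw [(hev o).2 (Or.inl (hk o (mem_posSupport.2 (by simpa using h0))))]
      simp
    · positivity
  have hzero := (Finset.sum_eq_zero_iff_of_nonneg hterm).1
    (le_antisymm (hankel_linearCombination f u v w ▸ hle) (Finset.sum_nonneg hterm))
  have hsub : posSupport f ⊆ {m} := fun o ho => by
    have ho' := mem_posSupport.1 ho
    have := hzero o (Finsupp.mem_support_iff.2 ho'.ne')
    rw [mul_eq_zero, pow_eq_zero_iff two_ne_zero, hev, or_iff_right ho'.ne'] at this
    rcases this with rfl | rfl
    · linarith
    · exact Finset.mem_singleton_self _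
  exact ⟨f, rfl, (Finset.card_le_card hsub).trans (Finset.card_singleton m).le, hf⟩

theorem exists_least_powerRep (A : Fin 5 → ℝ) :
    ∃ m n, PowerRep m n A ∧ ∀ a b, PowerRep a b A → m ≤ a ∧ n ≤ b := by
  classical
  have psd (A : Fin 5 → ℝ) (hA : HankelPSD A) :
      ∃ m, PowerRep m 0 A ∧ ∀ a b, PowerRep a b A → m ≤ a :=
    have hex : ∃ m, PowerRep m 0 A := ⟨3, hA.rep_three.1⟩
    ⟨Nat.find hex, Nat.find_spec hex, fun a b h => Nat.find_min' hex (hA.rep_of_rep h)⟩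
  by_cases hA : HankelPSD A
  · obtain ⟨m, hm, hmin⟩ := psd A hA
    exact ⟨m, 0, hm, fun a b h => ⟨hmin a b h, b.zero_le⟩⟩
  by_cases hA' : HankelPSD (-A)
  · obtain ⟨m, hm, hmin⟩ := psd (-A) hA'
    exact ⟨0, m, by simpa using hm.neg, fun a b h => ⟨a.zero_le, hmin b a h.neg⟩⟩
  have hb (a b : ℕ) (h : PowerRep a b A) : 1 ≤ b := by
    by_contra! hb
    obtain rfl : b = 0 := by omega
    exact hA h.hankelPSD
  have ha (a b : ℕ) (h : PowerRep a b A) : 1 ≤ a := by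
    by_contra! ha
    obtain rfl : a = 0 := by omega
    exact hA' h.neg.hankelPSD
  have h22 := rep_two_two_of_indefinite hA hA'
  by_cases h1 : ∃ a, PowerRep a 1 A
  · obtain ⟨a₁, h1⟩ := h1
    have h21 := h1.two_one hA
    by_cases h2 : ∃ b, PowerRep 1 b A
    · obtain ⟨b₁, h2⟩ := h2
      exact ⟨1, 1, h21.one_one h2, fun a b h => ⟨ha a b h, hb a b h⟩⟩
    · refine ⟨2, 1, h21, fun a b h => ⟨?_, hb a b h⟩⟩
      by_contra! hlt
      exact h2 ⟨b, h.mono (by omega) le_rfl⟩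
  · have hb' (a b : ℕ) (h : PowerRep a b A) : 2 ≤ b := by
      by_contra! hlt
      exact h1 ⟨a, h.mono le_rfl (by omega)⟩
    by_cases h2 : ∃ b, PowerRep 1 b A
    · obtain ⟨b₁, h2⟩ := h2
      have h12 := (h2.neg.two_one hA').neg
      rw [neg_neg] at h12
      exact ⟨1, 2, h12, fun a b h => ⟨ha a b h, hb' a b h⟩⟩
    · refine ⟨2, 2, h22, fun a b h => ⟨?_, hb' a b h⟩⟩
      by_contra! hlt
      exact h2 ⟨b, h.mono (by omega) le_rfl⟩

/-- The binary quartic form with given coefficients relative to the binomial basis. -/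
noncomputable def quarticForm : (Fin 5 → ℝ) →ₗ[ℝ] MvPolynomial (Fin 2) ℝ where
  toFun A := A 0 • X 0 ^ 4 + (4 * A 1) • (X 0 ^ 3 * X 1) + (6 * A 2) • (X 0 ^ 2 * X 1 ^ 2) +
    (4 * A 3) • (X 0 * X 1 ^ 3) + A 4 • X 1 ^ 4
  map_add' A B := by simp only [Pi.add_apply]; module
  map_smul' t A := by simp only [Pi.smul_apply, smul_eq_mul, RingHom.id_apply]; module

theorem quarticForm_apply (A : Fin 5 → ℝ) :
    quarticForm A = A 0 • X 0 ^ 4 + (4 * A 1) • (X 0 ^ 3 * X 1) +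
      (6 * A 2) • (X 0 ^ 2 * X 1 ^ 2) + (4 * A 3) • (X 0 * X 1 ^ 3) + A 4 • X 1 ^ 4 := rfl

theorem quarticForm_injective : Function.Injective quarticForm := by
  rw [injective_iff_map_eq_zero]
  intro A h
  have key (x y : ℝ) : A 0 * x ^ 4 + 4 * A 1 * (x ^ 3 * y) + 6 * A 2 * (x ^ 2 * y ^ 2) +
      4 * A 3 * (x * y ^ 3) + A 4 * y ^ 4 = 0 := by
    have := congrArg (eval ![x, y]) h
    simpa [quarticForm_apply, smul_eval] using this
  have k1 := key 1 0
  have k2 := key 0 1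
  have k3 := key 1 1
  have k4 := key 1 (-1)
  have k5 := key 1 2
  ext i
  fin_cases i <;> simp only [Fin.zero_eta, Fin.mk_one, Fin.reduceFinMk, Pi.zero_apply] <;> linarith

theorem mem_range_quarticForm {p : MvPolynomial (Fin 2) ℝ}
    (hp : p ∈ homogeneousSubmodule (Fin 2) ℝ 4) : p ∈ LinearMap.range quarticForm := by
  rw [p.as_sum]
  refine Submodule.sum_mem _ fun d hd => ?_
  have hdeg : d 0 + d 1 = 4 := by
    have := (mem_homogeneousSubmodule _ _).1 hp (mem_support_iff.1 hd)
    simpa [Finsupp.weight_apply, Finsupp.sum_fintype] using this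
  generalize coeff d p = c
  have hmon : monomial d c = C c * (X 0 ^ d 0 * X 1 ^ d 1) := by
    rw [monomial_eq, Finsupp.prod_fintype _ _ (fun _ => pow_zero _), Fin.prod_univ_two]
  rw [hmon, ← smul_eq_C_mul]
  refine Submodule.smul_mem _ c ?_
  obtain ⟨i, hi⟩ : ∃ i, i = d 1 := ⟨_, rfl⟩
  have h0 : d 0 = 4 - i := by omega
  have hi4 : i ≤ 4 := by omega
  rw [h0, ← hi]
  interval_cases i
  · exact ⟨![1, 0, 0, 0, 0], by simp [quarticForm_apply]⟩
  · exact ⟨![0, 1 / 4, 0, 0, 0], by simp [quarticForm_apply]⟩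
  · exact ⟨![0, 0, 1 / 6, 0, 0], by simp [quarticForm_apply]⟩
  · exact ⟨![0, 0, 0, 1 / 4, 0], by simp [quarticForm_apply]⟩
  · exact ⟨![0, 0, 0, 0, 1], by simp [quarticForm_apply]⟩

theorem quarticForm_veronese (x y : ℝ) : quarticForm (veronese x y) =
    (x • X 0 + y • X 1 : MvPolynomial (Fin 2) ℝ) ^ (2 * 2) := by
  simp only [quarticForm_apply, veronese, Matrix.cons_val, smul_eq_C_mul, map_mul, map_pow,
    map_ofNat]
  ring

theorem exists_veronese_eq_smul_moment (x y : ℝ) :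
    ∃ (o : Option ℝ) (c : ℝ), 0 ≤ c ∧ veronese x y = c • moment o := by
  by_cases hx : x = 0
  · refine ⟨none, y ^ 4, by positivity, ?_⟩
    ext i
    fin_cases i <;> simp [hx, veronese, moment, coordX, coordY]
  · refine ⟨some (y / x), x ^ 4, by positivity, ?_⟩
    ext i
    fin_cases i <;> simp [veronese, moment, coordX, coordY] <;> field_simp

theorem card_posSupport_sum_single_le {r : ℕ} (o : Fin r → Option ℝ) (μ : Fin r → ℝ) :
    (posSupport (∑ k, Finsupp.single (o k) (μ k))).card ≤ Nat.card {k : Fin r // 0 < μ k} := by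
  classical
  rw [Nat.card_eq_fintype_card, Fintype.card_subtype]
  refine (Finset.card_le_card fun i hi => ?_).trans
    (Finset.card_image_le (f := o) (s := Finset.univ.filter fun k => 0 < μ k))
  rw [mem_posSupport, Finsupp.finsetSum_apply] at hi
  obtain ⟨k, -, hk⟩ := Finset.exists_lt_of_sum_lt
    (f := fun _ : Fin r => (0 : ℝ)) (by simpa using hi)
  rw [Finsupp.single_apply] at hk
  split_ifs at hk with hki
  · exact Finset.mem_image.2 ⟨k, by simpa using hk, hki⟩
  · exact absurd hk (lt_irrefl _)

theorem powerRep_of_mem_badges {A : Fin 5 → ℝ} {a b : ℕ} (h : (a, b) ∈ badges 2 (quarticForm A)) :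
    PowerRep a b A := by
  obtain ⟨r, lam, α, β, ⟨-, -, hsum⟩, ha, hb⟩ := h
  simp only at ha hb
  choose o c hc hoc using fun k => exists_veronese_eq_smul_moment (α k) (β k)
  have hA : A = ∑ k, (lam k * c k) • moment (o k) := by
    apply quarticForm_injective
    simp only [hsum, map_sum, map_smul, mul_smul, ← hoc, quarticForm_veronese]
  refine ⟨∑ k, Finsupp.single (o k) (lam k * c k), ?_, ?_, ?_⟩
  · rw [hA, map_sum]
    exact Finset.sum_congr rfl fun k _ => Finsupp.linearCombination_single _ _ _
  · rw [ha]
    refine (card_posSupport_sum_single_le _ _).trans (Nat.card_le_card_of_injective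
      (Subtype.map id fun k hk => pos_of_mul_pos_left hk (hc k))
      (Subtype.map_injective _ Function.injective_id))
  · rw [hb, ← Finset.sum_neg_distrib]
    simp only [← Finsupp.single_neg]
    refine (card_posSupport_sum_single_le _ _).trans (Nat.card_le_card_of_injective
      (Subtype.map id fun k hk => ?_) (Subtype.map_injective _ Function.injective_id))
    rw [← neg_mul] at hk
    exact neg_pos.1 (pos_of_mul_pos_left hk (hc k))

theorem card_eq_card_subtype_equiv {ι κ : Type*} {s t : Finset κ} (e : ι ≃ t) {P : κ → Prop}
    (hs : s ⊆ t) (hP : ∀ i, i ∈ s ↔ P i) : s.card = Nat.card {k : ι // P (e k)} := by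
  rw [← Nat.card_eq_finsetCard]
  exact Nat.card_congr
    { toFun := fun i => ⟨e.symm ⟨i, hs i.2⟩, by simpa using (hP _).1 i.2⟩
      invFun := fun k => ⟨e k, (hP _).2 k.2⟩
      left_inv := fun i => by simp
      right_inv := fun k => by simp }

theorem mem_badges_linearCombination (f : Option ℝ →₀ ℝ) :
    ((posSupport f).card, (posSupport (-f)).card) ∈
      badges 2 (quarticForm (Finsupp.linearCombination ℝ moment f)) := by
  let e := f.support.equivFin.symm
  refine ⟨_, fun k => f (e k), fun k => coordX (e k), fun k => coordY (e k),
    ⟨fun k => Finsupp.mem_support_iff.1 (e k).2, fun k l hkl => ?_, ?_⟩, ?_, ?_⟩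
  · exact (coord_det_eq_zero_iff _ _).not.2 fun h => hkl (e.injective (Subtype.ext h))
  · simp only [Finsupp.linearCombination_apply, Finsupp.sum, map_sum, map_smul, moment,
      quarticForm_veronese]
    rw [← Finset.sum_coe_sort, ← e.sum_comp]
  · exact card_eq_card_subtype_equiv e (Finset.filter_subset _ _) fun i => mem_posSupport
  · refine card_eq_card_subtype_equiv e (P := fun i => f i < 0) ?_ fun i => ?_
    · exact (Finset.filter_subset _ _).trans (Finsupp.support_neg f).le
    · rw [mem_posSupport, Finsupp.neg_apply, neg_pos]

theorem stmt13 (p : MvPolynomial (Fin 2) ℝ)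
    (hp : p ∈ MvPolynomial.homogeneousSubmodule (Fin 2) ℝ 4) :
    ∃! ab : ℕ × ℕ, IsSignature 2 p ab := by
  obtain ⟨A, rfl⟩ := mem_range_quarticForm hp
  obtain ⟨m, n, ⟨f, hf, hfm, hfn⟩, hmin⟩ := exists_least_powerRep A
  have hbadge := mem_badges_linearCombination f
  rw [hf] at hbadge
  obtain ⟨hm, hn⟩ := hmin _ _ (powerRep_of_mem_badges hbadge)
  rw [le_antisymm hfm hm, le_antisymm hfn hn] at hbadge
  refine ⟨(m, n), ⟨hbadge, fun cd hcd h1 h2 => ?_⟩, fun ab hab => ?_⟩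
  · obtain ⟨h3, h4⟩ := hmin _ _ (powerRep_of_mem_badges hcd)
    exact Prod.ext (le_antisymm h1 h3) (le_antisymm h2 h4)
  · obtain ⟨h3, h4⟩ := hmin _ _ (powerRep_of_mem_badges hab.1)
    exact (hab.2 _ hbadge h3 h4).symm
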